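/- arXiv:1702.08414 — 4 statements merged into one kernel-verified Lean document; each statement's English description precedes it below -/
import Mathlib

section
/- Let S ⊆ V be a nondegenerate 2-dimensional subspace, so that V = S ⊕ S^{⊥ω}, and let f : S → S^{⊥ω} be a linear map. Let d ∈ ℝ be the unique real number with ω(f(a), f(b)) = d·ω(a,b) for all a,b ∈ S (the symplectic determinant of f). Then the 2-dimensional subspace graph(f) = {a + f(a) : a ∈ S} ⊆ V is nondegenerate (i.e. ω restricted to it is nondegenerate) if and only if d ≠ −1. -/
/-- The symplectic orthogonal complement `S^{⊥ω} = {x : ω(x,s) = 0 ∀ s ∈ S}`. -/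
def symPerp {V : Type*} [AddCommGroup V] [Module ℝ V]
    (ω : V →ₗ[ℝ] V →ₗ[ℝ] ℝ) (S : Submodule ℝ V) : Submodule ℝ V where
  carrier := {x | ∀ s ∈ S, ω x s = 0}
  add_mem' := by
    intro a b ha hb s hs
    rw [map_add, LinearMap.add_apply, ha s hs, hb s hs, add_zero]
  zero_mem' := by
    intro s hs
    simp
  smul_mem' := by
    intro c a ha s hs
    rw [map_smul, LinearMap.smul_apply, ha s hs, smul_zero]

/-- On the graph of a map into `S^{⊥ω}` with symplectic determinant `d`, the form `ω` is
`1 + d` times its pullback from `S`. -/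
theorem apply_graph_eq {V : Type*} [AddCommGroup V] [Module ℝ V]
    {ω : V →ₗ[ℝ] V →ₗ[ℝ] ℝ} (halt : ω.IsAlt) {S : Submodule ℝ V}
    {f : S →ₗ[ℝ] V} (hf : ∀ a : S, f a ∈ symPerp ω S)
    {d : ℝ} (hd : ∀ a b : S, ω (f a) (f b) = d * ω (a : V) (b : V)) (a b : S) :
    ω ((a : V) + f a) ((b : V) + f b) = (1 + d) * ω (a : V) (b : V) := by
  have hab : ω (f a) b = 0 := hf a b b.2
  have hba : ω a (f b) = 0 := by rw [← halt.neg, hf b a a.2, neg_zero]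
  simp only [map_add, LinearMap.add_apply, hab, hba, hd]
  ring

/-- The projection of the graph to a nondegenerate `S` is injective. -/
theorem eq_zero_of_add_apply_eq_zero {V : Type*} [AddCommGroup V] [Module ℝ V]
    {ω : V →ₗ[ℝ] V →ₗ[ℝ] ℝ} {S : Submodule ℝ V}
    (hSnd : ∀ x ∈ S, (∀ y ∈ S, ω x y = 0) → x = 0)
    {f : S →ₗ[ℝ] V} (hf : ∀ a : S, f a ∈ symPerp ω S) {a : S}
    (ha : (a : V) + f a = 0) : a = 0 := by
  refine Subtype.ext (hSnd a a.2 fun y hy => ?_)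
  rw [eq_neg_of_add_eq_zero_left ha, map_neg, LinearMap.neg_apply, hf a y hy, neg_zero]

/-- For a nondegenerate 2-dimensional subspace `S` of the 4-dimensional
symplectic space `(V,ω)` and a linear map `f : S → S^{⊥ω}` with symplectic determinant `d`
(`ω(f a, f b) = d·ω(a,b)`), the graph `{a + f(a) : a ∈ S}` is a nondegenerate subspace
iff `d ≠ -1`. -/
theorem stmt_12 (V : Type*) [AddCommGroup V] [Module ℝ V]
    (hdim : Module.finrank ℝ V = 4)
    (ω : V →ₗ[ℝ] V →ₗ[ℝ] ℝ) (halt : ∀ x : V, ω x x = 0)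
    (hnd : ∀ x : V, (∀ y : V, ω x y = 0) → x = 0)
    (S : Submodule ℝ V) (hS2 : Module.finrank ℝ S = 2)
    (hSnd : ∀ x ∈ S, (∀ y ∈ S, ω x y = 0) → x = 0)
    (f : S →ₗ[ℝ] V) (hf : ∀ a : S, f a ∈ symPerp ω S)
    (d : ℝ) (hd : ∀ a b : S, ω (f a) (f b) = d * ω (a : V) (b : V)) :
    (∀ x ∈ LinearMap.range (S.subtype + f),
        (∀ y ∈ LinearMap.range (S.subtype + f), ω x y = 0) → x = 0) ↔ d ≠ -1 := by
  constructor
  · rintro h rfl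
    have hzero : ∀ a : S, a = 0 := fun a => by
      refine eq_zero_of_add_apply_eq_zero hSnd hf (h _ ⟨a, rfl⟩ ?_)
      rintro _ ⟨b, rfl⟩
      simpa using apply_graph_eq halt hf hd a b
    have : Subsingleton S := ⟨fun a b => (hzero a).trans (hzero b).symm⟩
    rw [Module.finrank_zero_of_subsingleton] at hS2
    exact absurd hS2 (by norm_num)
  · rintro hne _ ⟨a, rfl⟩ h
    have hd1 : 1 + d ≠ 0 := fun h0 => hne (by linarith)
    have ha : a = 0 := by
      refine Subtype.ext (hSnd a a.2 fun y hy => ?_)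
      have hay := h _ ⟨⟨y, hy⟩, rfl⟩
      have hmul := (apply_graph_eq halt hf hd a ⟨y, hy⟩).symm.trans hay
      exact (mul_eq_zero.mp hmul).resolve_left hd1
    rw [ha, map_zero]
end

section
/- Let S ⊆ V be a nondegenerate 2-dimensional subspace, V = S ⊕ S^{⊥ω}, and let f : S → S^{⊥ω} be a linear map whose symplectic determinant d (defined by ω(f(a),f(b)) = d·ω(a,b) for all a,b ∈ S) satisfies d ≠ −1. Let Adj(f) : S^{⊥ω} → S be the unique linear map satisfying ω(a, Adj(f)(b)) = ω(f(a), b) for all a ∈ S, b ∈ S^{⊥ω}. Then the symplectic orthogonal complement of graph(f) = {a + f(a) : a ∈ S} in V is transverse to S and equals graph(−Adj(f)) = {b − Adj(f)(b) : b ∈ S^{⊥ω}}. -/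
/-- Every vector is congruent, modulo the symplectic complement of a finite-dimensional
nondegenerate subspace, to a vector of that subspace. -/
theorem exists_sub_mem_symPerp {V : Type*} [AddCommGroup V] [Module ℝ V]
    (ω : V →ₗ[ℝ] V →ₗ[ℝ] ℝ) (S : Submodule ℝ V) [FiniteDimensional ℝ S]
    (hSnd : ∀ x ∈ S, (∀ y ∈ S, ω x y = 0) → x = 0) (x : V) :
    ∃ a ∈ S, x - a ∈ symPerp ω S := by
  let φ : S →ₗ[ℝ] Module.Dual ℝ S := ω.compl₁₂ S.subtype S.subtype
  have hinj : Function.Injective φ := by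
    rw [injective_iff_map_eq_zero]
    intro a ha
    refine Subtype.ext (hSnd a a.2 fun y hy => ?_)
    exact LinearMap.congr_fun ha ⟨y, hy⟩
  have hsurj : Function.Surjective φ :=
    (LinearMap.injective_iff_surjective_of_finrank_eq_finrank
      Subspace.dual_finrank_eq.symm).mp hinj
  obtain ⟨a, ha⟩ := hsurj ((ω x).comp S.subtype)
  refine ⟨a, a.2, fun s hs => ?_⟩
  have h : ω a s = ω x s := LinearMap.congr_fun ha ⟨s, hs⟩
  rw [map_sub, LinearMap.sub_apply, h, sub_self]

/-- With `S` a nondegenerate 2-dimensional subspace of the 4-dimensional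
symplectic space `(V,ω)`, `f : S → S^{⊥ω}` with symplectic determinant `d ≠ -1`, and
`g = Adj(f) : S^{⊥ω} → S` the adjugate (`ω(a, g b) = ω(f a, b)`), the symplectic orthogonal
complement of `graph f = {a + f(a)}` is transverse to `S` and equals
`graph (-g) = {b - g(b)}`. -/
theorem stmt_13 (V : Type*) [AddCommGroup V] [Module ℝ V]
    (hdim : Module.finrank ℝ V = 4)
    (ω : V →ₗ[ℝ] V →ₗ[ℝ] ℝ) (halt : ∀ x : V, ω x x = 0)
    (hnd : ∀ x : V, (∀ y : V, ω x y = 0) → x = 0)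
    (S : Submodule ℝ V) (hS2 : Module.finrank ℝ S = 2)
    (hSnd : ∀ x ∈ S, (∀ y ∈ S, ω x y = 0) → x = 0)
    (f : S →ₗ[ℝ] V) (hf : ∀ a : S, f a ∈ symPerp ω S)
    (d : ℝ) (hd : ∀ a b : S, ω (f a) (f b) = d * ω (a : V) (b : V)) (hdne : d ≠ -1)
    (g : symPerp ω S →ₗ[ℝ] V) (hg : ∀ b : symPerp ω S, g b ∈ S)
    (hadj : ∀ (a : S) (b : symPerp ω S), ω (a : V) (g b) = ω (f a) (b : V)) :
    symPerp ω (LinearMap.range (S.subtype + f)) ⊓ S = ⊥ ∧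
    symPerp ω (LinearMap.range (S.subtype + f)) =
      LinearMap.range ((symPerp ω S).subtype - g) := by
  have hskew : ∀ x y : V, ω x y = -ω y x := by
    intro x y
    have h := halt (x + y)
    simp only [map_add, LinearMap.add_apply, halt] at h
    linarith
  have : FiniteDimensional ℝ S := Module.finite_of_finrank_pos (by omega)
  have hSf : ∀ a ∈ S, ∀ s : S, ω a (f s) = 0 := by
    intro a ha s
    rw [hskew, hf s a ha, neg_zero]
  have hbf : ∀ (b : symPerp ω S) (s : S), ω (b : V) (f s) = ω (g b) (s : V) := by
    intro b s
    rw [hskew, ← hadj, hskew (s : V), neg_neg]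
  refine ⟨?_, ?_⟩
  · rw [eq_bot_iff]
    rintro x ⟨hx, hxS⟩
    refine hSnd x hxS fun y hy => ?_
    have h : ω x (y + f ⟨y, hy⟩) = 0 := hx _ ⟨⟨y, hy⟩, rfl⟩
    rwa [map_add, hSf x hxS, add_zero] at h
  · ext x
    constructor
    · intro hx
      obtain ⟨a, ha, hb⟩ := exists_sub_mem_symPerp ω S hSnd x
      refine ⟨⟨x - a, hb⟩, ?_⟩
      have key : a + g ⟨x - a, hb⟩ = 0 := by
        refine hSnd _ (S.add_mem ha (hg _)) fun y hy => ?_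
        have h : ω x (y + f ⟨y, hy⟩) = 0 := hx _ ⟨⟨y, hy⟩, rfl⟩
        have h1 := hbf ⟨x - a, hb⟩ ⟨y, hy⟩
        have h2 := hb y hy
        have h3 := hSf a ha ⟨y, hy⟩
        simp only [map_add, map_sub, LinearMap.add_apply, LinearMap.sub_apply] at h h1 h2 ⊢
        linarith
      change x - a - g ⟨x - a, hb⟩ = x
      rw [sub_sub, key, sub_zero]
    · rintro ⟨b, rfl⟩ _ ⟨s, rfl⟩
      change ω ((b : V) - g b) ((s : V) + f s) = 0
      have h1 := hbf b s
      have h2 := b.2 s s.2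
      have h3 := hSf (g b) (hg b) s
      simp only [map_add, map_sub, LinearMap.sub_apply]
      linarith
end

section
/- Let u₊, u₋, v₊, v₋ ∈ V be a lightlike quadrilateral and let C be the crooked surface it determines. Then for a nonzero vector p ∈ V, the photon of p is disjoint from C (i.e. no Lagrangian plane belonging to C contains p) if and only if ω(p,v₊)·ω(p,u₊) > 0 and ω(p,v₋)·ω(p,u₋) < 0. -/
/-- A Lagrangian plane of `(V, ω)`: a 2-dimensional subspace on which `ω` vanishes. -/
def IsLagrangian {V : Type*} [AddCommGroup V] [Module ℝ V]
    (ω : V →ₗ[ℝ] V →ₗ[ℝ] ℝ) (L : Submodule ℝ V) : Prop :=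
  Module.finrank ℝ L = 2 ∧ ∀ x ∈ L, ∀ y ∈ L, ω x y = 0

/-- Membership of a Lagrangian plane `L` in the stem of the crooked surface determined by the
lightlike quadrilateral `up, um, vp, vm`, where `q` is the quadratic form
`q(x) = ω(π₀ x, π∞ x)`: `L` is spanned by nonzero vectors `w ∈ S₁ = span {up, vm}` and
`w' ∈ S₂ = span {um, vp}` and `q` is definite on `L`. -/
def InStem {V : Type*} [AddCommGroup V] [Module ℝ V]
    (up um vp vm : V) (q : V → ℝ) (L : Submodule ℝ V) : Prop :=
  ∃ w w' : V, w ≠ 0 ∧ w' ≠ 0 ∧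
    w ∈ Submodule.span ℝ ({up, vm} : Set V) ∧
    w' ∈ Submodule.span ℝ ({um, vp} : Set V) ∧
    L = Submodule.span ℝ ({w, w'} : Set V) ∧
    ((∀ x ∈ L, x ≠ 0 → 0 < q x) ∨ (∀ x ∈ L, x ≠ 0 → q x < 0))

/-- Membership in the crooked surface determined by the lightlike quadrilateral
`up, um, vp, vm`: a Lagrangian plane belonging to one of the two wings or to the stem. -/
def InCrooked {V : Type*} [AddCommGroup V] [Module ℝ V]
    (ω : V →ₗ[ℝ] V →ₗ[ℝ] ℝ) (up um vp vm : V) (q : V → ℝ) (L : Submodule ℝ V) : Prop :=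
  IsLagrangian ω L ∧
    ((∃ t s : ℝ, t • up + s • vp ≠ 0 ∧ 0 ≤ t * s ∧ t • up + s • vp ∈ L) ∨
     (∃ t s : ℝ, t • um + s • vm ≠ 0 ∧ t * s ≤ 0 ∧ t • um + s • vm ∈ L) ∨
     InStem up um vp vm q L)

/-- In dimension 4, every vector `ω`-orthogonal to a nonzero vector `p` lies in a common
Lagrangian plane with `p`. -/
theorem exists_isLagrangian_mem_mem {V : Type*} [AddCommGroup V] [Module ℝ V]
    (hdim : Module.finrank ℝ V = 4)
    (ω : V →ₗ[ℝ] V →ₗ[ℝ] ℝ) (halt : ∀ x : V, ω x x = 0)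
    {p x : V} (hp : p ≠ 0) (hpx : ω p x = 0) :
    ∃ L : Submodule ℝ V, IsLagrangian ω L ∧ p ∈ L ∧ x ∈ L := by
  have hanti : ∀ x y, ω x y = -ω y x := fun x y => by
    have h := halt (x + y)
    simp only [map_add, LinearMap.add_apply, halt] at h
    linarith
  have key : ∀ y : V, ω p y = 0 → y ∉ Submodule.span ℝ ({p} : Set V) →
      IsLagrangian ω (Submodule.span ℝ ({p, y} : Set V)) := by
    intro y hy hyp
    constructor
    · have hli : LinearIndependent ℝ ![p, y] := by
        rw [LinearIndependent.pair_iff' hp]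
        intro a ha
        exact hyp (Submodule.mem_span_singleton.2 ⟨a, ha⟩)
      have h := finrank_span_eq_card hli
      rwa [Matrix.range_cons_cons_empty, Fintype.card_fin] at h
    · intro u hu v hv
      obtain ⟨a, b, rfl⟩ := Submodule.mem_span_pair.1 hu
      obtain ⟨c, d, rfl⟩ := Submodule.mem_span_pair.1 hv
      simp [halt, hy, hanti y p]
  by_cases hx : x ∈ Submodule.span ℝ ({p} : Set V)
  · have hfin : FiniteDimensional ℝ V := Module.finite_of_finrank_pos (by omega)
    have hnle : ¬ LinearMap.ker (ω p) ≤ Submodule.span ℝ ({p} : Set V) := by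
      intro hle
      have e1 := Submodule.finrank_mono hle
      have e2 := (ω p).finrank_range_add_finrank_ker
      have e3 := (LinearMap.range (ω p)).finrank_le
      rw [finrank_span_singleton hp] at e1
      rw [Module.finrank_self] at e3
      omega
    obtain ⟨y, hy, hyp⟩ := SetLike.not_le_iff_exists.1 hnle
    exact ⟨_, key y hy hyp, Submodule.subset_span (by simp),
      Submodule.span_mono (by simp) hx⟩
  · exact ⟨_, key x hpx hx, Submodule.subset_span (by simp), Submodule.subset_span (by simp)⟩

/-- the photon of a nonzero vector `p` is disjoint from the crooked surface `C`
of the lightlike quadrilateral `up, um, vp, vm` iff `ω(p,vp)·ω(p,up) > 0` and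
`ω(p,vm)·ω(p,um) < 0`. -/
theorem stmt_15 (V : Type*) [AddCommGroup V] [Module ℝ V]
    (hdim : Module.finrank ℝ V = 4)
    (ω : V →ₗ[ℝ] V →ₗ[ℝ] ℝ) (halt : ∀ x : V, ω x x = 0)
    (hnd : ∀ x : V, (∀ y : V, ω x y = 0) → x = 0)
    (up um vp vm : V)
    (h1 : ω up vm = 1) (h2 : ω um vp = 1)
    (h3 : ω up um = 0) (h4 : ω up vp = 0) (h5 : ω um vm = 0) (h6 : ω vp vm = 0)
    (π₀ πinf : V →ₗ[ℝ] V)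
    (hπ₀ : ∀ x : V, π₀ x ∈ Submodule.span ℝ ({vp, vm} : Set V))
    (hπinf : ∀ x : V, πinf x ∈ Submodule.span ℝ ({up, um} : Set V))
    (hsum : ∀ x : V, π₀ x + πinf x = x)
    (p : V) (hp : p ≠ 0) :
    (∀ L : Submodule ℝ V,
        InCrooked ω up um vp vm (fun x => ω (π₀ x) (πinf x)) L → p ∉ L) ↔
      (0 < ω p vp * ω p up ∧ ω p vm * ω p um < 0) := by
  have hanti : ∀ x y, ω x y = -ω y x := fun x y => by
    have h := halt (x + y)
    simp only [map_add, LinearMap.add_apply, halt] at h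
    linarith
  have h1' : ω vm up = -1 := by rw [hanti, h1]
  have h2' : ω vp um = -1 := by rw [hanti, h2]
  have h3' : ω um up = 0 := by rw [hanti, h3, neg_zero]
  have h4' : ω vp up = 0 := by rw [hanti, h4, neg_zero]
  have h5' : ω vm um = 0 := by rw [hanti, h5, neg_zero]
  have h6' : ω vm vp = 0 := by rw [hanti, h6, neg_zero]
  have hq : ∀ x, ω (π₀ x) (πinf x) = ω x um * ω x vp + ω x up * ω x vm := by
    intro x
    obtain ⟨c, d, hcd⟩ := Submodule.mem_span_pair.1 (hπ₀ x)
    obtain ⟨a, b, hab⟩ := Submodule.mem_span_pair.1 (hπinf x)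
    have hx : x = (c • vp + d • vm) + (a • up + b • um) := by rw [hcd, hab, hsum]
    rw [← hcd, ← hab, hx]
    simp [halt, h1, h2, h3, h4, h5, h6, h1', h2', h3', h4', h5', h6']
  constructor
  · intro h
    constructor
    · by_contra! hle
      obtain ⟨t, s, hne, hts, h0⟩ : ∃ t s : ℝ, t • up + s • vp ≠ 0 ∧ 0 ≤ t * s ∧
          ω p (t • up + s • vp) = 0 := by
        by_cases hz : ω p up = 0
        · refine ⟨1, 0, fun h0 => ?_, by simp, by simp [hz]⟩
          simpa [h1] using congrArg (fun y => ω y vm) h0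
        · refine ⟨ω p vp, -ω p up, fun h0 => hz ?_, by linarith, by simp; ring⟩
          simpa [h3', h2', h3] using congrArg (fun y => ω y um) h0
      obtain ⟨L, hL, hpL, hxL⟩ := exists_isLagrangian_mem_mem hdim ω halt hp h0
      exact h L ⟨hL, Or.inl ⟨t, s, hne, hts, hxL⟩⟩ hpL
    · by_contra! hle
      obtain ⟨t, s, hne, hts, h0⟩ : ∃ t s : ℝ, t • um + s • vm ≠ 0 ∧ t * s ≤ 0 ∧
          ω p (t • um + s • vm) = 0 := by
        by_cases hz : ω p um = 0
        · refine ⟨1, 0, fun h0 => ?_, by simp, by simp [hz]⟩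
          simpa [h2] using congrArg (fun y => ω y vp) h0
        · refine ⟨ω p vm, -ω p um, fun h0 => hz ?_, by linarith, by simp; ring⟩
          simpa [h3', h1'] using congrArg (fun y => ω y up) h0
      obtain ⟨L, hL, hpL, hxL⟩ := exists_isLagrangian_mem_mem hdim ω halt hp h0
      exact h L ⟨hL, Or.inr (Or.inl ⟨t, s, hne, hts, hxL⟩)⟩ hpL
  · rintro ⟨hpos, hneg⟩ L ⟨hL, hC⟩ hpL
    rcases hC with ⟨t, s, hne, hts, hxL⟩ | ⟨t, s, hne, hts, hxL⟩ | hstem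
    · have h0 := hL.2 p hpL _ hxL
      simp only [map_add, map_smul, smul_eq_mul] at h0
      have ht : t = 0 := by
        by_contra ht
        have := mul_pos (sq_pos_of_ne_zero ht) hpos
        have e : t ^ 2 * (ω p vp * ω p up) = -(t * s) * ω p vp ^ 2 := by
          linear_combination (t * ω p vp) * h0
        nlinarith [mul_nonneg hts (sq_nonneg (ω p vp))]
      have hs : s = 0 := by
        subst ht
        rcases mul_eq_zero.1 (by simpa using h0 : s * ω p vp = 0) with h | h
        · exact h
        · simp [h] at hpos
      simp [ht, hs] at hne
    · have h0 := hL.2 p hpL _ hxL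
      simp only [map_add, map_smul, smul_eq_mul] at h0
      have ht : t = 0 := by
        by_contra ht
        have := mul_pos (sq_pos_of_ne_zero ht) (neg_pos.2 hneg)
        have e : t ^ 2 * (ω p vm * ω p um) = -(t * s) * ω p vm ^ 2 := by
          linear_combination (t * ω p vm) * h0
        nlinarith [mul_nonneg (neg_nonneg.2 hts) (sq_nonneg (ω p vm))]
      have hs : s = 0 := by
        subst ht
        rcases mul_eq_zero.1 (by simpa using h0 : s * ω p vm = 0) with h | h
        · exact h
        · simp [h] at hneg
      simp [ht, hs] at hne
    · obtain ⟨w, w', hw, hw', hwS, hwS', rfl, hdef⟩ := hstem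
      obtain ⟨k, l, rfl⟩ := Submodule.mem_span_pair.1 hpL
      have hwL : w ∈ Submodule.span ℝ ({w, w'} : Set V) := Submodule.subset_span (by simp)
      have hwL' : w' ∈ Submodule.span ℝ ({w, w'} : Set V) := Submodule.subset_span (by simp)
      have hprod : 0 < ω (π₀ w) (πinf w) * ω (π₀ w') (πinf w') := by
        rcases hdef with hd | hd
        · exact mul_pos (hd w hwL hw) (hd w' hwL' hw')
        · exact mul_pos_of_neg_of_neg (hd w hwL hw) (hd w' hwL' hw')
      obtain ⟨a, d, rfl⟩ := Submodule.mem_span_pair.1 hwS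
      obtain ⟨b, c, rfl⟩ := Submodule.mem_span_pair.1 hwS'
      rw [hq, hq] at hprod
      simp only [map_add, map_smul, LinearMap.add_apply, LinearMap.smul_apply, smul_eq_mul, halt,
        h1, h2, h3, h4, h5, h6, h1', h2', h3', h4', h5', h6'] at hprod hpos hneg
      nlinarith [mul_pos hpos (neg_pos.2 hneg), mul_nonneg (sq_nonneg (k * l)) hprod.le]
end

section
/- Let u₊, u₋, v₊, v₋ and u′₊, u′₋, v′₊, v′₋ be two lightlike quadrilaterals in V with crooked surfaces C and C′ respectively. Then C and C′ are disjoint (no Lagrangian plane belongs to both) if and only if: for each p ∈ {u′₊, u′₋, v′₊, v′₋} no Lagrangian plane belonging to C contains p, and for each p ∈ {u₊, u₋, v₊, v₋} no Lagrangian plane belonging to C′ contains p. -/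
/-- A lightlike quadrilateral of `(V, ω)`, together with the expansion of every vector in it. -/
structure LightlikeQuad {V : Type*} [AddCommGroup V] [Module ℝ V]
    (ω : V →ₗ[ℝ] V →ₗ[ℝ] ℝ) where
  up : V
  um : V
  vp : V
  vm : V
  up_vm : ω up vm = 1
  um_vp : ω um vp = 1
  up_um : ω up um = 0
  up_vp : ω up vp = 0
  um_vm : ω um vm = 0
  vp_vm : ω vp vm = 0
  alt : ω.IsAlt
  expand : ∀ x, x = ω x vm • up + ω x vp • um + (-ω x um) • vp + (-ω x up) • vm

section Planes

variable {V : Type*} [AddCommGroup V] [Module ℝ V] {ω : V →ₗ[ℝ] V →ₗ[ℝ] ℝ}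

lemma isLagrangian_span_pair (hω : ω.IsAlt) {x y : V} (hli : LinearIndependent ℝ ![x, y])
    (hxy : ω x y = 0) : IsLagrangian ω (Submodule.span ℝ {x, y}) := by
  have hyx : ω y x = 0 := by rw [← hω.neg, hxy, neg_zero]
  refine ⟨?_, ?_⟩
  · have h := finrank_span_eq_card hli
    rwa [Matrix.range_cons_cons_empty, Fintype.card_fin] at h
  · intro z hz z' hz'
    obtain ⟨a, b, rfl⟩ := Submodule.mem_span_pair.1 hz
    obtain ⟨c, d, rfl⟩ := Submodule.mem_span_pair.1 hz'
    simp [hxy, hyx, hω.self_eq_zero]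

lemma IsLagrangian.eq_span_pair {L : Submodule ℝ V} (hL : IsLagrangian ω L) {x y : V}
    (hli : LinearIndependent ℝ ![x, y]) (hx : x ∈ L) (hy : y ∈ L) :
    L = Submodule.span ℝ {x, y} := by
  have : FiniteDimensional ℝ L := Module.finite_of_finrank_pos (by rw [hL.1]; norm_num)
  refine (Submodule.eq_of_le_of_finrank_eq ?_ ?_).symm
  · rw [Submodule.span_le]
    rintro z (rfl | rfl)
    exacts [hx, hy]
  · have h := finrank_span_eq_card hli
    rw [hL.1]
    rwa [Matrix.range_cons_cons_empty, Fintype.card_fin] at h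

/-- Two orthogonal vectors, one of which lies in a given Lagrangian plane, lie in a common
Lagrangian plane. -/
lemma exists_isLagrangian_mem (hω : ω.IsAlt) {L₀ : Submodule ℝ V} (hL₀ : IsLagrangian ω L₀)
    {p z : V} (hz : z ∈ L₀) (hz0 : z ≠ 0) (hpz : ω p z = 0) :
    ∃ L, IsLagrangian ω L ∧ p ∈ L ∧ z ∈ L := by
  by_cases hli : LinearIndependent ℝ ![z, p]
  · have hzp : ω z p = 0 := by rw [← hω.neg, hpz, neg_zero]
    exact ⟨_, isLagrangian_span_pair hω hli hzp, Submodule.subset_span (by simp),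
      Submodule.subset_span (by simp)⟩
  · rw [LinearIndependent.pair_iff' hz0] at hli
    push Not at hli
    obtain ⟨a, rfl⟩ := hli
    exact ⟨L₀, hL₀, L₀.smul_mem a hz, hz⟩

end Planes

/-- The kernel of a singular `2 × 2` real matrix is nontrivial. -/
lemma exists_pair_of_minor_eq_zero {A B C D : ℝ} (h : A * D - B * C = 0) :
    ∃ l m : ℝ, (l ≠ 0 ∨ m ≠ 0) ∧ l * A + m * C = 0 ∧ l * B + m * D = 0 := by
  by_cases h1 : A = 0 ∧ C = 0
  · by_cases h2 : B = 0 ∧ D = 0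
    · exact ⟨1, 0, by simp, by simp [h1], by simp [h2]⟩
    · refine ⟨D, -B, ?_, ?_, by ring⟩
      · by_contra hc
        push Not at hc
        exact h2 ⟨by linarith [hc.2], hc.1⟩
      · simp [h1]
  · refine ⟨C, -A, ?_, by ring, by linarith⟩
    by_contra hc
    push Not at hc
    exact h1 ⟨by linarith [hc.2], hc.1⟩

/-- Bilinear combinations with weakly equal signs of two equally signed rows keep a positive
product. -/
lemma mul_comb_pos {A B C D t s : ℝ} (hts : 0 ≤ t * s) (h0 : t ≠ 0 ∨ s ≠ 0)
    (hAC : 0 < A * C) (hBD : 0 < B * D) (hAB : 0 < A * B) (hCD : 0 < C * D) :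
    0 < (t * A + s * B) * (t * C + s * D) := by
  have hAD : 0 < A * D := by
    have : 0 < (A * D) * (C ^ 2) := by nlinarith [mul_pos hAC hCD]
    exact pos_of_mul_pos_left this (sq_nonneg C)
  have hBC : 0 < B * C := by
    have : 0 < (B * C) * (A ^ 2) := by nlinarith [mul_pos hAC hAB]
    exact pos_of_mul_pos_left this (sq_nonneg A)
  have key : (t * A + s * B) * (t * C + s * D)
      = t ^ 2 * (A * C) + (t * s) * (A * D + B * C) + s ^ 2 * (B * D) := by ring
  rw [key]
  have h1 : 0 ≤ (t * s) * (A * D + B * C) := by positivity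
  rcases h0 with h | h
  · have := mul_pos (pow_pos (abs_pos.2 h) 2) hAC
    rw [sq_abs] at this
    have h2 : 0 ≤ s ^ 2 * (B * D) := by positivity
    linarith
  · have := mul_pos (pow_pos (abs_pos.2 h) 2) hBD
    rw [sq_abs] at this
    have h2 : 0 ≤ t ^ 2 * (A * C) := by positivity
    linarith

namespace LightlikeQuad

variable {V : Type*} [AddCommGroup V] [Module ℝ V] {ω : V →ₗ[ℝ] V →ₗ[ℝ] ℝ}
  (Q : LightlikeQuad ω)

/-- The quadratic form `q` in terms of the coordinates of the quadrilateral. -/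
def form (x : V) : ℝ := ω x Q.vm * ω x Q.up + ω x Q.vp * ω x Q.um

/-- The crooked surface of the quadrilateral. -/
def Mem (L : Submodule ℝ V) : Prop := InCrooked ω Q.up Q.um Q.vp Q.vm Q.form L

/-- `L` lies on one of the four photons of the quadrilateral. -/
def HasVertex (L : Submodule ℝ V) : Prop := Q.up ∈ L ∨ Q.um ∈ L ∨ Q.vp ∈ L ∨ Q.vm ∈ L

lemma vm_up : ω Q.vm Q.up = -1 := by rw [← Q.alt.neg, Q.up_vm]
lemma vp_um : ω Q.vp Q.um = -1 := by rw [← Q.alt.neg, Q.um_vp]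
lemma um_up : ω Q.um Q.up = 0 := by rw [← Q.alt.neg, Q.up_um, neg_zero]
lemma vp_up : ω Q.vp Q.up = 0 := by rw [← Q.alt.neg, Q.up_vp, neg_zero]
lemma vm_um : ω Q.vm Q.um = 0 := by rw [← Q.alt.neg, Q.um_vm, neg_zero]
lemma vm_vp : ω Q.vm Q.vp = 0 := by rw [← Q.alt.neg, Q.vp_vm, neg_zero]

lemma up_ne : Q.up ≠ 0 := fun h => by simpa [h] using Q.up_vm
lemma um_ne : Q.um ≠ 0 := fun h => by simpa [h] using Q.um_vp
lemma vp_ne : Q.vp ≠ 0 := fun h => by simpa [h] using Q.um_vp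
lemma vm_ne : Q.vm ≠ 0 := fun h => by simpa [h] using Q.up_vm

/-- The values of `ω` on the quadrilateral, for use by `simp`. -/
lemma table : ω Q.up Q.up = 0 ∧ ω Q.um Q.um = 0 ∧ ω Q.vp Q.vp = 0 ∧ ω Q.vm Q.vm = 0 ∧
    ω Q.up Q.vm = 1 ∧ ω Q.um Q.vp = 1 ∧ ω Q.up Q.um = 0 ∧ ω Q.up Q.vp = 0 ∧
    ω Q.um Q.vm = 0 ∧ ω Q.vp Q.vm = 0 ∧ ω Q.vm Q.up = -1 ∧ ω Q.vp Q.um = -1 ∧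
    ω Q.um Q.up = 0 ∧ ω Q.vp Q.up = 0 ∧ ω Q.vm Q.um = 0 ∧ ω Q.vm Q.vp = 0 :=
  ⟨Q.alt _, Q.alt _, Q.alt _, Q.alt _, Q.up_vm, Q.um_vp, Q.up_um, Q.up_vp, Q.um_vm, Q.vp_vm,
    Q.vm_up, Q.vp_um, Q.um_up, Q.vp_up, Q.vm_um, Q.vm_vp⟩

lemma apply_eq (x y : V) : ω x y = ω x Q.up * ω y Q.vm - ω x Q.vm * ω y Q.up
    + (ω x Q.um * ω y Q.vp - ω x Q.vp * ω y Q.um) := by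
  conv_lhs => rw [Q.expand y]
  simp only [map_add, map_smul, smul_eq_mul]
  ring

lemma linearIndependent_up_vp : LinearIndependent ℝ ![Q.up, Q.vp] := by
  rw [LinearIndependent.pair_iff]
  intro s t h
  have h1 := congrArg (fun z => ω z Q.vm) h
  have h2 := congrArg (fun z => ω z Q.um) h
  simp [Q.table] at h1 h2
  exact ⟨h1, h2⟩

lemma linearIndependent_um_vm : LinearIndependent ℝ ![Q.um, Q.vm] := by
  rw [LinearIndependent.pair_iff]
  intro s t h
  have h1 := congrArg (fun z => ω z Q.vp) h
  have h2 := congrArg (fun z => ω z Q.up) h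
  simp [Q.table] at h1 h2
  exact ⟨h1, h2⟩

lemma mem_of_hasVertex {L : Submodule ℝ V} (hL : IsLagrangian ω L) (h : Q.HasVertex L) :
    Q.Mem L := by
  refine ⟨hL, ?_⟩
  rcases h with h | h | h | h
  · exact .inl ⟨1, 0, by simp [Q.up_ne], by simp, by simpa⟩
  · exact .inr (.inl ⟨1, 0, by simp [Q.um_ne], by simp, by simpa⟩)
  · exact .inl ⟨0, 1, by simp [Q.vp_ne], by simp, by simpa⟩
  · exact .inr (.inl ⟨0, 1, by simp [Q.vm_ne], by simp, by simpa⟩)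

/-- The inequalities saying that the photon of `p` misses the crooked surface. -/
def Avoids (p : V) : Prop := 0 < ω p Q.vp * ω p Q.up ∧ ω p Q.vm * ω p Q.um < 0

lemma avoids_of_forall_notMem {p : V} (h : ∀ L, Q.Mem L → p ∉ L) : Q.Avoids p := by
  have hup := isLagrangian_span_pair Q.alt Q.linearIndependent_up_vp Q.up_vp
  have hum := isLagrangian_span_pair Q.alt Q.linearIndependent_um_vm Q.um_vm
  have hp : ∀ t s : ℝ, t • Q.up + s • Q.vp ≠ 0 → 0 ≤ t * s →
      t * ω p Q.up + s * ω p Q.vp ≠ 0 := by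
    intro t s h0 hts hz
    obtain ⟨L, hL, hpL, hzL⟩ := exists_isLagrangian_mem (p := p) Q.alt hup
      (Submodule.mem_span_pair.2 ⟨t, s, rfl⟩) h0 (by simpa using hz)
    exact h L ⟨hL, .inl ⟨t, s, h0, hts, hzL⟩⟩ hpL
  have hm : ∀ t s : ℝ, t • Q.um + s • Q.vm ≠ 0 → t * s ≤ 0 →
      t * ω p Q.um + s * ω p Q.vm ≠ 0 := by
    intro t s h0 hts hz
    obtain ⟨L, hL, hpL, hzL⟩ := exists_isLagrangian_mem (p := p) Q.alt hum
      (Submodule.mem_span_pair.2 ⟨t, s, rfl⟩) h0 (by simpa using hz)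
    exact h L ⟨hL, .inr (.inl ⟨t, s, h0, hts, hzL⟩)⟩ hpL
  have h1 := hp 1 0 (by simp [Q.up_ne]) (by simp)
  have h2 := hm 1 0 (by simp [Q.um_ne]) (by simp)
  simp only [one_mul, zero_mul, add_zero] at h1 h2
  constructor
  · by_contra hc
    refine hp (ω p Q.vp) (-ω p Q.up) (fun h0 => ?_) (by linarith) (by ring)
    exact h1 (neg_eq_zero.1 ((LinearIndependent.pair_iff.1 Q.linearIndependent_up_vp _ _ h0).2))
  · by_contra hc
    refine hm (ω p Q.vm) (-ω p Q.um) (fun h0 => ?_) (by linarith) (by ring)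
    exact h2 (neg_eq_zero.1 ((LinearIndependent.pair_iff.1 Q.linearIndependent_um_vm _ _ h0).2))

lemma form_mul_form_pos {L : Submodule ℝ V} {w w' : V} (hw : w ≠ 0) (hw' : w' ≠ 0)
    (hwL : w ∈ L) (hwL' : w' ∈ L)
    (hq : (∀ x ∈ L, x ≠ 0 → 0 < Q.form x) ∨ (∀ x ∈ L, x ≠ 0 → Q.form x < 0)) :
    0 < Q.form w * Q.form w' := by
  rcases hq with hq | hq
  · exact mul_pos (hq _ hwL hw) (hq _ hwL' hw')
  · exact mul_pos_of_neg_of_neg (hq _ hwL hw) (hq _ hwL' hw')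

/-- Coordinates on the stem. -/
lemma exists_coords_of_inStem {L : Submodule ℝ V}
    (h : InStem Q.up Q.um Q.vp Q.vm Q.form L) :
    ∃ a b c d : ℝ, 0 < a * d * (b * c) ∧
      L = Submodule.span ℝ {a • Q.up + d • Q.vm, b • Q.um + c • Q.vp} := by
  obtain ⟨w, w', hw, hw', hws, hws', rfl, hq⟩ := h
  have := Q.form_mul_form_pos hw hw' (Submodule.subset_span (by simp))
    (Submodule.subset_span (by simp)) hq
  obtain ⟨a, d, rfl⟩ := Submodule.mem_span_pair.1 hws
  obtain ⟨b, c, rfl⟩ := Submodule.mem_span_pair.1 hws'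
  refine ⟨a, b, c, d, ?_, rfl⟩
  simp [form, Q.table] at this
  linarith

lemma inStem_of_coords {a b c d : ℝ} (h : 0 < a * d * (b * c)) :
    InStem Q.up Q.um Q.vp Q.vm Q.form
      (Submodule.span ℝ {a • Q.up + d • Q.vm, b • Q.um + c • Q.vp}) := by
  have hform : ∀ l m : ℝ,
      Q.form (l • (a • Q.up + d • Q.vm) + m • (b • Q.um + c • Q.vp))
        = -(l ^ 2 * (a * d) + m ^ 2 * (b * c)) := by
    intro l m
    simp [form, Q.table]
    ring
  have hw : a • Q.up + d • Q.vm ≠ 0 := by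
    intro h0
    have := congrArg (fun z => ω z Q.vm) h0
    simp [Q.table] at this
    simp [this] at h
  have hw' : b • Q.um + c • Q.vp ≠ 0 := by
    intro h0
    have := congrArg (fun z => ω z Q.vp) h0
    simp [Q.table] at this
    simp [this] at h
  refine ⟨_, _, hw, hw', Submodule.mem_span_pair.2 ⟨a, d, rfl⟩,
    Submodule.mem_span_pair.2 ⟨b, c, rfl⟩, rfl, ?_⟩
  have key : ∀ x ∈ Submodule.span ℝ {a • Q.up + d • Q.vm, b • Q.um + c • Q.vp}, x ≠ 0 →
      ∃ l m : ℝ, (l ≠ 0 ∨ m ≠ 0) ∧ Q.form x = -(l ^ 2 * (a * d) + m ^ 2 * (b * c)) := by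
    intro x hx hx0
    obtain ⟨l, m, rfl⟩ := Submodule.mem_span_pair.1 hx
    refine ⟨l, m, ?_, hform l m⟩
    by_contra hc
    push Not at hc
    simp [hc] at hx0
  have pos : ∀ {A B l m : ℝ}, 0 < A → 0 < B → (l ≠ 0 ∨ m ≠ 0) → 0 < l ^ 2 * A + m ^ 2 * B := by
    rintro A B l m hA hB (h | h) <;> positivity
  rcases pos_and_pos_or_neg_and_neg_of_mul_pos h with ⟨h1, h2⟩ | ⟨h1, h2⟩
  · right
    intro x hx hx0
    obtain ⟨l, m, hlm, hf⟩ := key x hx hx0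
    linarith [pos h1 h2 hlm]
  · left
    intro x hx hx0
    obtain ⟨l, m, hlm, hf⟩ := key x hx hx0
    linarith [pos (neg_pos.2 h1) (neg_pos.2 h2) hlm]

lemma Avoids.notMem {p : V} (hp : Q.Avoids p) {L : Submodule ℝ V} (hL : Q.Mem L) : p ∉ L := by
  intro hpL
  obtain ⟨h1, h2⟩ := hp
  obtain ⟨hlag, ⟨t, s, h0, hts, hz⟩ | ⟨t, s, h0, hts, hz⟩ | hstem⟩ := hL
  · have h := hlag.2 _ hpL _ hz
    simp only [map_add, map_smul, smul_eq_mul] at h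
    have ht : t = 0 := by
      by_contra ht
      have : 0 < t ^ 2 * (ω p Q.vp * ω p Q.up) := by positivity
      nlinarith [mul_nonneg hts (sq_nonneg (ω p Q.vp)), congrArg (t * ω p Q.vp * ·) h]
    have hs : s = 0 := by
      subst ht
      simp only [zero_mul, zero_add, mul_eq_zero] at h
      exact h.resolve_right (by rintro h; simp [h] at h1)
    simp [ht, hs] at h0
  · have h := hlag.2 _ hpL _ hz
    simp only [map_add, map_smul, smul_eq_mul] at h
    have ht : t = 0 := by
      by_contra ht
      have : 0 < t ^ 2 * (-(ω p Q.vm * ω p Q.um)) :=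
        mul_pos (by positivity) (neg_pos.2 h2)
      nlinarith [mul_nonneg (neg_nonneg.2 hts) (sq_nonneg (ω p Q.vm)),
        congrArg (t * ω p Q.vm * ·) h]
    have hs : s = 0 := by
      subst ht
      simp only [zero_mul, zero_add, mul_eq_zero] at h
      exact h.resolve_right (by rintro h; simp [h] at h2)
    simp [ht, hs] at h0
  · obtain ⟨a, b, c, d, habcd, rfl⟩ := Q.exists_coords_of_inStem hstem
    obtain ⟨l, m, rfl⟩ := Submodule.mem_span_pair.1 hpL
    simp [Q.table] at h1 h2
    have := mul_neg_of_neg_of_pos h1 h2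
    nlinarith [mul_nonneg (mul_nonneg (sq_nonneg l) (sq_nonneg m)) habcd.le]

/-- All four vertices of `Q'` avoid the crooked surface of `Q`. -/
def AvoidsVertices (Q' : LightlikeQuad ω) : Prop :=
  Q.Avoids Q'.up ∧ Q.Avoids Q'.um ∧ Q.Avoids Q'.vp ∧ Q.Avoids Q'.vm

lemma avoidsVertices_of_forall {Q' : LightlikeQuad ω}
    (h : ∀ L, Q.Mem L → ¬ Q'.HasVertex L) : Q.AvoidsVertices Q' := by
  refine ⟨?_, ?_, ?_, ?_⟩ <;> refine Q.avoids_of_forall_notMem fun L hL hp => h L hL ?_ <;>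
    simp [HasVertex, hp]

lemma avoids_wing_plus {Q' : LightlikeQuad ω} (h : Q.AvoidsVertices Q')
    (h' : Q'.AvoidsVertices Q) {t s : ℝ} (h0 : t • Q.up + s • Q.vp ≠ 0) (hts : 0 ≤ t * s) :
    Q'.Avoids (t • Q.up + s • Q.vp) := by
  have hn : t ≠ 0 ∨ s ≠ 0 := by
    by_contra hc
    push Not at hc
    simp [hc] at h0
  obtain ⟨⟨a1, a2⟩, ⟨b1, b2⟩, ⟨c1, c2⟩, d1, d2⟩ := h
  obtain ⟨⟨a1', a2'⟩, ⟨b1', b2'⟩, ⟨c1', c2'⟩, d1', d2'⟩ := h'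
  have sk : ∀ x y, ω x y = -ω y x := fun x y => (Q.alt.neg y x).symm
  rw [sk _ Q.vp, sk _ Q.up] at a1 b1 c1 d1
  constructor
  · have := mul_comb_pos hts hn a1' c1' (by linarith : 0 < ω Q.up Q'.vp * ω Q.vp Q'.vp)
      (by linarith : 0 < ω Q.up Q'.up * ω Q.vp Q'.up)
    simpa using this
  · have := mul_comb_pos (A := ω Q.up Q'.vm) (B := ω Q.vp Q'.vm) (C := -ω Q.up Q'.um)
      (D := -ω Q.vp Q'.um) hts hn (by linarith) (by linarith) (by linarith) (by linarith)
    simp only [map_add, map_smul, LinearMap.add_apply, LinearMap.smul_apply, smul_eq_mul]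
    linarith

lemma avoids_wing_minus {Q' : LightlikeQuad ω} (h : Q.AvoidsVertices Q')
    (h' : Q'.AvoidsVertices Q) {t s : ℝ} (h0 : t • Q.um + s • Q.vm ≠ 0) (hts : t * s ≤ 0) :
    Q'.Avoids (t • Q.um + s • Q.vm) := by
  have hn : t ≠ 0 ∨ -s ≠ 0 := by
    by_contra hc
    push Not at hc
    rw [neg_eq_zero] at hc
    simp [hc] at h0
  have hts' : 0 ≤ t * -s := by linarith
  obtain ⟨⟨a1, a2⟩, ⟨b1, b2⟩, ⟨c1, c2⟩, d1, d2⟩ := h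
  obtain ⟨⟨a1', a2'⟩, ⟨b1', b2'⟩, ⟨c1', c2'⟩, d1', d2'⟩ := h'
  have sk : ∀ x y, ω x y = -ω y x := fun x y => (Q.alt.neg y x).symm
  rw [sk _ Q.vm, sk _ Q.um] at a2 b2 c2 d2
  constructor
  · have := mul_comb_pos (A := ω Q.um Q'.vp) (B := -ω Q.vm Q'.vp) (C := ω Q.um Q'.up)
      (D := -ω Q.vm Q'.up) hts' hn (by linarith) (by linarith) (by linarith) (by linarith)
    simp only [map_add, map_smul, LinearMap.add_apply, LinearMap.smul_apply, smul_eq_mul]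
    linarith
  · have := mul_comb_pos (A := ω Q.um Q'.vm) (B := -ω Q.vm Q'.vm) (C := -ω Q.um Q'.um)
      (D := ω Q.vm Q'.um) hts' hn (by linarith) (by linarith) (by linarith) (by linarith)
    simp only [map_add, map_smul, LinearMap.add_apply, LinearMap.smul_apply, smul_eq_mul]
    linarith

/-- The Plücker coordinate whose vanishing says that the Lagrangian plane `⟨x, y⟩` splits along
`S₁ ⊕ S₂`. -/
def splitMinor (x y : V) : ℝ := ω x Q.up * ω y Q.vm - ω x Q.vm * ω y Q.up

/-- A product of two Plücker coordinates whose sign tells on which side of the four photons a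
split plane `⟨x, y⟩` lies. -/
def signProduct (x y : V) : ℝ :=
  (ω x Q.vm * ω y Q.vp - ω x Q.vp * ω y Q.vm) * (ω x Q.up * ω y Q.um - ω x Q.um * ω y Q.up)

lemma splitMinor_comb (x y : V) (α β γ δ : ℝ) :
    Q.splitMinor (α • x + β • y) (γ • x + δ • y) = (α * δ - β * γ) * Q.splitMinor x y := by
  simp [splitMinor]
  ring

lemma signProduct_comb (x y : V) (α β γ δ : ℝ) :
    Q.signProduct (α • x + β • y) (γ • x + δ • y)
      = (α * δ - β * γ) ^ 2 * Q.signProduct x y := by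
  simp [signProduct]
  ring

lemma splitMinor_coords (a b c d : ℝ) :
    Q.splitMinor (a • Q.up + d • Q.vm) (b • Q.um + c • Q.vp) = 0 := by
  simp [splitMinor, Q.table]

lemma signProduct_coords (a b c d : ℝ) :
    Q.signProduct (a • Q.up + d • Q.vm) (b • Q.um + c • Q.vp) = a * d * (b * c) := by
  simp [signProduct, Q.table]
  ring

lemma linearIndependent_coords {a b c d : ℝ} (h : a ≠ 0 ∨ d ≠ 0) (h' : b ≠ 0 ∨ c ≠ 0) :
    LinearIndependent ℝ ![a • Q.up + d • Q.vm, b • Q.um + c • Q.vp] := by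
  rw [LinearIndependent.pair_iff]
  intro s t hst
  have e1 := congrArg (fun z => ω z Q.vm) hst
  have e2 := congrArg (fun z => ω z Q.up) hst
  have e3 := congrArg (fun z => ω z Q.vp) hst
  have e4 := congrArg (fun z => ω z Q.um) hst
  simp [Q.table] at e1 e2 e3 e4
  tauto

lemma det_ne_zero_of_linearIndependent {x y : V} {α β γ δ : ℝ}
    (h : LinearIndependent ℝ ![α • x + β • y, γ • x + δ • y]) : α * δ - β * γ ≠ 0 := by
  intro h0
  obtain ⟨l, m, hlm, h1, h2⟩ := exists_pair_of_minor_eq_zero h0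
  have := LinearIndependent.pair_iff.1 h l m (by
    have : l • (α • x + β • y) + m • (γ • x + δ • y)
        = (l * α + m * γ) • x + (l * β + m * δ) • y := by module
    rw [this, h1, h2]
    simp)
  tauto

lemma split_of_inStem {x y : V} (hli : LinearIndependent ℝ ![x, y])
    (h : InStem Q.up Q.um Q.vp Q.vm Q.form (Submodule.span ℝ {x, y})) :
    Q.splitMinor x y = 0 ∧ 0 < Q.signProduct x y := by
  obtain ⟨a, b, c, d, habcd, hL⟩ := Q.exists_coords_of_inStem h
  have hx : x ∈ Submodule.span ℝ {x, y} := Submodule.subset_span (by simp)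
  have hy : y ∈ Submodule.span ℝ {x, y} := Submodule.subset_span (by simp)
  rw [hL] at hx hy
  obtain ⟨α, β, rfl⟩ := Submodule.mem_span_pair.1 hx
  obtain ⟨γ, δ, rfl⟩ := Submodule.mem_span_pair.1 hy
  have := det_ne_zero_of_linearIndependent hli
  rw [splitMinor_comb, splitMinor_coords, signProduct_comb, signProduct_coords]
  exact ⟨mul_zero _, by positivity⟩

/-- A split Lagrangian plane is spanned by vectors of `S₁` and `S₂`. -/
lemma exists_coords_of_split {x y : V} (hli : LinearIndependent ℝ ![x, y]) (hxy : ω x y = 0)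
    (hs : Q.splitMinor x y = 0) :
    ∃ a b c d k : ℝ, k ≠ 0 ∧ a * d * (b * c) = k ^ 2 * Q.signProduct x y ∧
      (a ≠ 0 ∨ d ≠ 0) ∧ (b ≠ 0 ∨ c ≠ 0) ∧
      Submodule.span ℝ {x, y}
        = Submodule.span ℝ {a • Q.up + d • Q.vm, b • Q.um + c • Q.vp} := by
  have hne : ∀ {l m : ℝ}, (l ≠ 0 ∨ m ≠ 0) → l • x + m • y ≠ 0 := by
    intro l m hlm h0
    have := LinearIndependent.pair_iff.1 hli l m h0
    tauto
  have happ := Q.apply_eq x y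
  unfold splitMinor at hs
  rw [hxy, hs, zero_add] at happ
  obtain ⟨l, m, hlm, h1, h2⟩ := exists_pair_of_minor_eq_zero happ.symm
  obtain ⟨l', m', hlm', h1', h2'⟩ := exists_pair_of_minor_eq_zero hs
  have e : l • x + m • y = ω (l • x + m • y) Q.vm • Q.up + (-ω (l • x + m • y) Q.up) • Q.vm := by
    have := Q.expand (l • x + m • y)
    rwa [show ω (l • x + m • y) Q.vp = 0 by simpa using h2,
      show ω (l • x + m • y) Q.um = 0 by simpa using h1, zero_smul, neg_zero, zero_smul,
      add_zero, add_zero] at this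
  have e' : l' • x + m' • y
      = ω (l' • x + m' • y) Q.vp • Q.um + (-ω (l' • x + m' • y) Q.um) • Q.vp := by
    have := Q.expand (l' • x + m' • y)
    rwa [show ω (l' • x + m' • y) Q.vm = 0 by simpa using h2',
      show ω (l' • x + m' • y) Q.up = 0 by simpa using h1', zero_smul, neg_zero, zero_smul,
      zero_add, add_zero] at this
  set a := ω (l • x + m • y) Q.vm
  set d := -ω (l • x + m • y) Q.up
  set b := ω (l' • x + m' • y) Q.vp
  set c := -ω (l' • x + m' • y) Q.um
  have had : a ≠ 0 ∨ d ≠ 0 := by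
    by_contra hc
    push Not at hc
    rw [hc.1, hc.2, zero_smul, zero_smul, add_zero] at e
    exact hne hlm e
  have hbc : b ≠ 0 ∨ c ≠ 0 := by
    by_contra hc
    push Not at hc
    rw [hc.1, hc.2, zero_smul, zero_smul, add_zero] at e'
    exact hne hlm' e'
  have hli' := Q.linearIndependent_coords had hbc
  refine ⟨a, b, c, d, l * m' - m * l', ?_, ?_, had, hbc, ?_⟩
  · rw [← e, ← e'] at hli'
    exact det_ne_zero_of_linearIndependent hli'
  · rw [← Q.signProduct_comb, ← Q.signProduct_coords, ← e, ← e']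
  · refine (isLagrangian_span_pair Q.alt hli hxy).eq_span_pair hli' ?_ ?_
    · rw [← e]
      exact Submodule.mem_span_pair.2 ⟨l, m, rfl⟩
    · rw [← e']
      exact Submodule.mem_span_pair.2 ⟨l', m', rfl⟩

lemma hasVertex_of_signProduct_eq_zero {x y : V} (hli : LinearIndependent ℝ ![x, y])
    (hxy : ω x y = 0) (hs : Q.splitMinor x y = 0) (hF : Q.signProduct x y = 0) :
    Q.HasVertex (Submodule.span ℝ {x, y}) := by
  obtain ⟨a, b, c, d, k, hk, heq, had, hbc, hL⟩ := Q.exists_coords_of_split hli hxy hs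
  rw [hL]
  rw [hF, mul_zero] at heq
  set L : Submodule ℝ V := Submodule.span ℝ {a • Q.up + d • Q.vm, b • Q.um + c • Q.vp}
  have h1 : a • Q.up + d • Q.vm ∈ L := Submodule.subset_span (by simp)
  have h2 : b • Q.um + c • Q.vp ∈ L := Submodule.subset_span (by simp)
  have hmem : ∀ {t : ℝ} {z : V}, t ≠ 0 → t • z ∈ L → z ∈ L :=
    fun hk h => (L.smul_mem_iff hk).1 h
  simp only [mul_eq_zero] at heq
  rcases heq with (h | h) | (h | h)
  · rw [h, zero_smul, zero_add] at h1
    exact .inr (.inr (.inr (hmem (had.resolve_left (not_not.2 h)) h1)))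
  · rw [h, zero_smul, add_zero] at h1
    exact .inl (hmem (had.resolve_right (not_not.2 h)) h1)
  · rw [h, zero_smul, zero_add] at h2
    exact .inr (.inr (.inl (hmem (hbc.resolve_left (not_not.2 h)) h2)))
  · rw [h, zero_smul, add_zero] at h2
    exact .inr (.inl (hmem (hbc.resolve_right (not_not.2 h)) h2))

lemma mem_of_signProduct_nonneg {x y : V} (hli : LinearIndependent ℝ ![x, y])
    (hxy : ω x y = 0) (hs : Q.splitMinor x y = 0) (hF : 0 ≤ Q.signProduct x y) :
    Q.Mem (Submodule.span ℝ {x, y}) := by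
  have hlag := isLagrangian_span_pair Q.alt hli hxy
  rcases hF.eq_or_lt with h | h
  · exact Q.mem_of_hasVertex hlag (Q.hasVertex_of_signProduct_eq_zero hli hxy hs h.symm)
  · refine ⟨hlag, .inr (.inr ?_)⟩
    obtain ⟨a, b, c, d, k, hk, heq, had, hbc, hL⟩ := Q.exists_coords_of_split hli hxy hs
    rw [hL]
    exact Q.inStem_of_coords (by rw [heq]; positivity)

/-- A path in the intersection of the two Einstein tori cannot lead from the common part of the
stems to the photons of `Q`. -/
lemma not_path {Q' : LightlikeQuad ω} (h : ∀ L, Q.Mem L → ¬ Q'.HasVertex L)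
    (h' : ∀ L, Q'.Mem L → ¬ Q.HasVertex L) {a b c d : ℝ → ℝ} (ha : Continuous a)
    (hb : Continuous b) (hc : Continuous c) (hd : Continuous d)
    (had : ∀ r ∈ Set.Icc (0 : ℝ) 1, a r ≠ 0 ∨ d r ≠ 0)
    (hbc : ∀ r ∈ Set.Icc (0 : ℝ) 1, b r ≠ 0 ∨ c r ≠ 0)
    (hs : ∀ r, Q'.splitMinor (a r • Q.up + d r • Q.vm) (b r • Q.um + c r • Q.vp) = 0)
    (hG0 : a 0 * d 0 * (b 0 * c 0) = 0) (hG1 : 0 < a 1 * d 1 * (b 1 * c 1))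
    (hF1 : 0 < Q'.signProduct (a 1 • Q.up + d 1 • Q.vm) (b 1 • Q.um + c 1 • Q.vp)) : False := by
  let G : ℝ → ℝ := fun r => a r * d r * (b r * c r)
  let F : ℝ → ℝ := fun r => Q'.signProduct (a r • Q.up + d r • Q.vm) (b r • Q.um + c r • Q.vp)
  have hG : Continuous G := by fun_prop
  have hF : Continuous F := by
    simp only [F, signProduct, map_add, map_smul, LinearMap.add_apply, LinearMap.smul_apply,
      smul_eq_mul]
    fun_prop
  have hcont : ContinuousOn (fun r => min (F r) (G r)) (Set.Icc 0 1) := (hF.min hG).continuousOn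
  obtain ⟨r, hr, hmin⟩ := intermediate_value_Icc zero_le_one hcont
    (show (0 : ℝ) ∈ Set.Icc _ _ from ⟨(min_le_right _ _).trans hG0.le, (lt_min hF1 hG1).le⟩)
  have hmin : min (F r) (G r) = 0 := hmin
  have hFr : 0 ≤ F r := hmin ▸ min_le_left _ _
  have hGr : 0 ≤ G r := hmin ▸ min_le_right _ _
  have hli := Q.linearIndependent_coords (had r hr) (hbc r hr)
  have horth : ω (a r • Q.up + d r • Q.vm) (b r • Q.um + c r • Q.vp) = 0 := by simp [Q.table]
  have hsQ := Q.splitMinor_coords (a r) (b r) (c r) (d r)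
  have hpQ := Q.signProduct_coords (a r) (b r) (c r) (d r)
  rcases min_choice (F r) (G r) with hm | hm <;> rw [hm] at hmin
  · exact h _ (Q.mem_of_signProduct_nonneg hli horth hsQ (hpQ ▸ hGr))
      (Q'.hasVertex_of_signProduct_eq_zero hli horth (hs r) hmin)
  · exact h' _ (Q'.mem_of_signProduct_nonneg hli horth (hs r) hFr)
      (Q.hasVertex_of_signProduct_eq_zero hli horth hsQ (hpQ.trans hmin))

lemma not_inStem_inStem {Q' : LightlikeQuad ω} (h : ∀ L, Q.Mem L → ¬ Q'.HasVertex L)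
    (h' : ∀ L, Q'.Mem L → ¬ Q.HasVertex L) {L : Submodule ℝ V}
    (hL : InStem Q.up Q.um Q.vp Q.vm Q.form L)
    (hL' : InStem Q'.up Q'.um Q'.vp Q'.vm Q'.form L) : False := by
  obtain ⟨a, b, c, d, hG, rfl⟩ := Q.exists_coords_of_inStem hL
  have ha : a ≠ 0 := by rintro rfl; simp at hG
  have hb : b ≠ 0 := by rintro rfl; simp at hG
  have hd : d ≠ 0 := by rintro rfl; simp at hG
  obtain ⟨hs, hF⟩ :=
    Q'.split_of_inStem (Q.linearIndependent_coords (.inl ha) (.inl hb)) hL'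
  have expand : ∀ a b c d : ℝ,
      Q'.splitMinor (a • Q.up + d • Q.vm) (b • Q.um + c • Q.vp)
        = b * (a * Q'.splitMinor Q.up Q.um + d * Q'.splitMinor Q.vm Q.um)
          + c * (a * Q'.splitMinor Q.up Q.vp + d * Q'.splitMinor Q.vm Q.vp) := by
    intro a b c d
    simp [splitMinor]
    ring
  rw [expand] at hs
  set N1 := Q'.splitMinor Q.up Q.um
  set N2 := Q'.splitMinor Q.up Q.vp
  set N3 := Q'.splitMinor Q.vm Q.um
  set N4 := Q'.splitMinor Q.vm Q.vp
  by_cases hA : a * N1 + d * N3 = 0 ∧ a * N2 + d * N4 = 0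
  · refine Q.not_path h h' (a := fun _ => a) (b := fun _ => b) (c := fun r => r * c)
      (d := fun _ => d) (by fun_prop) (by fun_prop) (by fun_prop) (by fun_prop)
      (fun _ _ => .inl ha) (fun _ _ => .inl hb) (fun r => ?_) (by simp) (by simpa using hG)
      (by simpa using hF)
    rw [expand, hA.1, hA.2]
    ring
  by_cases hB : N1 * b + N2 * c = 0 ∧ N3 * b + N4 * c = 0
  · refine Q.not_path h h' (a := fun _ => a) (b := fun _ => b) (c := fun _ => c)
      (d := fun r => r * d) (by fun_prop) (by fun_prop) (by fun_prop) (by fun_prop)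
      (fun _ _ => .inl ha) (fun _ _ => .inl hb) (fun r => ?_) (by simp) (by simpa using hG)
      (by simpa using hF)
    rw [expand]
    linear_combination a * hB.1 + r * d * hB.2
  obtain ⟨k, hk⟩ : ∃ k, a * N2 + d * N4 = k * b := ⟨(a * N2 + d * N4) / b, by field_simp⟩
  have hk' : -(a * N1 + d * N3) = k * c := by
    apply mul_left_cancel₀ hb
    linear_combination -hs + c * hk
  have hk0 : k ≠ 0 := by
    rintro rfl
    exact hA ⟨by linarith, by linarith⟩
  refine Q.not_path h h' (a := fun _ => a) (b := fun r => a * N2 + r * d * N4)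
    (c := fun r => -(a * N1 + r * d * N3)) (d := fun r => r * d) (by fun_prop) (by fun_prop)
    (by fun_prop) (by fun_prop) (fun _ _ => .inl ha) (fun r _ => ?_) (fun r => ?_) (by simp)
    ?_ ?_
  · by_contra hcon
    push Not at hcon
    obtain ⟨h1, h2⟩ := hcon
    have h3 : (1 - r) * d * (N3 * b + N4 * c) = 0 := by
      linear_combination hs - c * h1 + b * h2
    rcases mul_eq_zero.1 h3 with h4 | h4
    · have hr : r = 1 := by
        have := (mul_eq_zero.1 h4).resolve_right hd
        linarith
      subst hr
      exact hA ⟨by linarith, by linarith⟩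
    · refine hB ⟨mul_left_cancel₀ ha ?_, h4⟩
      linear_combination hs - d * h4
  · rw [expand]
    ring
  · simp only [one_mul]
    rw [hk, hk']
    have : a * d * (k * b * (k * c)) = k ^ 2 * (a * d * (b * c)) := by ring
    rw [this]
    positivity
  · simp only [one_mul]
    rw [hk, hk']
    have := Q'.signProduct_comb (a • Q.up + d • Q.vm) (b • Q.um + c • Q.vp) 1 0 0 k
    have e : (0 : ℝ) • (a • Q.up + d • Q.vm) + k • (b • Q.um + c • Q.vp)
        = (k * b) • Q.um + (k * c) • Q.vp := by module
    rw [e, one_smul, zero_smul, add_zero] at this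
    rw [this]
    have : (1 * k - 0 * 0) ^ 2 = k ^ 2 := by ring
    rw [this]
    positivity

theorem disjoint_iff (Q' : LightlikeQuad ω) :
    (¬ ∃ L, Q.Mem L ∧ Q'.Mem L) ↔
      (∀ L, Q.Mem L → ¬ Q'.HasVertex L) ∧ (∀ L, Q'.Mem L → ¬ Q.HasVertex L) := by
  constructor
  · intro h
    exact ⟨fun L hL hv => h ⟨L, hL, Q'.mem_of_hasVertex hL.1 hv⟩,
      fun L hL hv => h ⟨L, Q.mem_of_hasVertex hL.1 hv, hL⟩⟩
  · rintro ⟨h, h'⟩ ⟨L, hL, hL'⟩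
    have hv := Q.avoidsVertices_of_forall h
    have hv' := Q'.avoidsVertices_of_forall h'
    obtain ⟨-, ⟨t, s, h0, hts, hz⟩ | ⟨t, s, h0, hts, hz⟩ | hstem⟩ := id hL
    · exact (Q.avoids_wing_plus hv hv' h0 hts).notMem Q' hL' hz
    · exact (Q.avoids_wing_minus hv hv' h0 hts).notMem Q' hL' hz
    obtain ⟨-, ⟨t, s, h0, hts, hz⟩ | ⟨t, s, h0, hts, hz⟩ | hstem'⟩ := id hL'
    · exact (Q'.avoids_wing_plus hv' hv h0 hts).notMem Q hL hz
    · exact (Q'.avoids_wing_minus hv' hv h0 hts).notMem Q hL hz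
    · exact Q.not_inStem_inStem h h' hstem hstem'

end LightlikeQuad

/-- The projections along `P₀ ⊕ P∞` give the expansion of vectors in the quadrilateral and the
coordinate formula for `q`. -/
lemma expand_of_projections {V : Type*} [AddCommGroup V] [Module ℝ V]
    {ω : V →ₗ[ℝ] V →ₗ[ℝ] ℝ} (halt : ω.IsAlt) {up um vp vm : V}
    (h1 : ω up vm = 1) (h2 : ω um vp = 1)
    (h3 : ω up um = 0) (h4 : ω up vp = 0) (h5 : ω um vm = 0) (h6 : ω vp vm = 0)
    {π₀ πinf : V →ₗ[ℝ] V}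
    (hπ₀ : ∀ x : V, π₀ x ∈ Submodule.span ℝ ({vp, vm} : Set V))
    (hπinf : ∀ x : V, πinf x ∈ Submodule.span ℝ ({up, um} : Set V))
    (hsum : ∀ x : V, π₀ x + πinf x = x) (x : V) :
    x = ω x vm • up + ω x vp • um + (-ω x um) • vp + (-ω x up) • vm ∧
      ω (π₀ x) (πinf x) = ω x vm * ω x up + ω x vp * ω x um := by
  obtain ⟨c, d, h0⟩ := Submodule.mem_span_pair.1 (hπ₀ x)
  obtain ⟨a, b, hinf⟩ := Submodule.mem_span_pair.1 (hπinf x)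
  have g1 : ω vm up = -1 := by rw [← halt.neg, h1]
  have g2 : ω vp um = -1 := by rw [← halt.neg, h2]
  have g3 : ω um up = 0 := by rw [← halt.neg, h3, neg_zero]
  have g4 : ω vp up = 0 := by rw [← halt.neg, h4, neg_zero]
  have g5 : ω vm um = 0 := by rw [← halt.neg, h5, neg_zero]
  have g6 : ω vm vp = 0 := by rw [← halt.neg, h6, neg_zero]
  have hx := hsum x
  rw [← h0, ← hinf] at hx ⊢
  have ea : ω x vm = a := by rw [← hx]; simp [h1, h5, h6, halt.self_eq_zero]
  have eb : ω x vp = b := by rw [← hx]; simp [h2, h4, g6, halt.self_eq_zero]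
  have ec : ω x um = -c := by rw [← hx]; simp [g2, h3, g5, halt.self_eq_zero]
  have ed : ω x up = -d := by rw [← hx]; simp [g1, g3, g4, halt.self_eq_zero]
  rw [ea, eb, ec, ed]
  refine ⟨?_, ?_⟩
  · conv_lhs => rw [← hx]
    module
  · simp [g1, g2, g4, g5]
    ring

/-- two crooked surfaces `C, C'` are disjoint iff the four photons of the
defining lightlike quadrilateral of each is disjoint from the other surface. -/
theorem stmt_17 (V : Type*) [AddCommGroup V] [Module ℝ V]
    (hdim : Module.finrank ℝ V = 4)
    (ω : V →ₗ[ℝ] V →ₗ[ℝ] ℝ) (halt : ∀ x : V, ω x x = 0)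
    (hnd : ∀ x : V, (∀ y : V, ω x y = 0) → x = 0)
    -- first lightlike quadrilateral
    (up um vp vm : V)
    (h1 : ω up vm = 1) (h2 : ω um vp = 1)
    (h3 : ω up um = 0) (h4 : ω up vp = 0) (h5 : ω um vm = 0) (h6 : ω vp vm = 0)
    (π₀ πinf : V →ₗ[ℝ] V)
    (hπ₀ : ∀ x : V, π₀ x ∈ Submodule.span ℝ ({vp, vm} : Set V))
    (hπinf : ∀ x : V, πinf x ∈ Submodule.span ℝ ({up, um} : Set V))
    (hsum : ∀ x : V, π₀ x + πinf x = x)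
    -- second lightlike quadrilateral
    (up' um' vp' vm' : V)
    (h1' : ω up' vm' = 1) (h2' : ω um' vp' = 1)
    (h3' : ω up' um' = 0) (h4' : ω up' vp' = 0) (h5' : ω um' vm' = 0) (h6' : ω vp' vm' = 0)
    (π₀' πinf' : V →ₗ[ℝ] V)
    (hπ₀' : ∀ x : V, π₀' x ∈ Submodule.span ℝ ({vp', vm'} : Set V))
    (hπinf' : ∀ x : V, πinf' x ∈ Submodule.span ℝ ({up', um'} : Set V))
    (hsum' : ∀ x : V, π₀' x + πinf' x = x) :
    (¬ ∃ L : Submodule ℝ V,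
        InCrooked ω up um vp vm (fun x => ω (π₀ x) (πinf x)) L ∧
        InCrooked ω up' um' vp' vm' (fun x => ω (π₀' x) (πinf' x)) L) ↔
      ((∀ L : Submodule ℝ V, InCrooked ω up um vp vm (fun x => ω (π₀ x) (πinf x)) L →
          up' ∉ L ∧ um' ∉ L ∧ vp' ∉ L ∧ vm' ∉ L) ∧
       (∀ L : Submodule ℝ V, InCrooked ω up' um' vp' vm' (fun x => ω (π₀' x) (πinf' x)) L →
          up ∉ L ∧ um ∉ L ∧ vp ∉ L ∧ vm ∉ L)) := by
  have e := expand_of_projections halt h1 h2 h3 h4 h5 h6 hπ₀ hπinf hsum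
  have e' := expand_of_projections halt h1' h2' h3' h4' h5' h6' hπ₀' hπinf' hsum'
  let Q : LightlikeQuad ω :=
    ⟨up, um, vp, vm, h1, h2, h3, h4, h5, h6, halt, fun x => (e x).1⟩
  let Q' : LightlikeQuad ω :=
    ⟨up', um', vp', vm', h1', h2', h3', h4', h5', h6', halt, fun x => (e' x).1⟩
  have hq : (fun x => ω (π₀ x) (πinf x)) = Q.form := funext fun x => (e x).2
  have hq' : (fun x => ω (π₀' x) (πinf' x)) = Q'.form := funext fun x => (e' x).2
  rw [hq, hq']
  simpa only [LightlikeQuad.Mem, LightlikeQuad.HasVertex, not_or] using Q.disjoint_iff Q'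
end
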